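/- For every n ≥ 2, each of the three difference measures D_{dΔ}(P||Q) = 4d(P||Q) − (1/4)Δ(P||Q), D_{dh}(P||Q) = 4d(P||Q) − h(P||Q), and D_{dI}(P||Q) = 4d(P||Q) − I(P||Q) is nonnegative for all P, Q ∈ Γₙ, and each of the three maps (P,Q) ↦ D_{dΔ}(P||Q), (P,Q) ↦ D_{dh}(P||Q), (P,Q) ↦ D_{dI}(P||Q) is convex on the convex set Γₙ × Γₙ ⊆ ℝⁿ × ℝⁿ. -/

import Mathlib

open Real BigOperators Finset

/-- The set of positive probability distributions on `Fin n`. -/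
def ProbDist (n : ℕ) : Set (Fin n → ℝ) :=
  {p | (∀ i, 0 < p i) ∧ ∑ i, p i = 1}

/-- Triangular discrimination `Δ(P‖Q)`. -/
noncomputable def triDelta {n : ℕ} (p q : Fin n → ℝ) : ℝ :=
  ∑ i, (p i - q i) ^ 2 / (p i + q i)

/-- Hellinger discrimination `h(P‖Q)`. -/
noncomputable def hellinger {n : ℕ} (p q : Fin n → ℝ) : ℝ :=
  (1 / 2) * ∑ i, (Real.sqrt (p i) - Real.sqrt (q i)) ^ 2

/-- Jensen–Shannon divergence `I(P‖Q)`. -/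
noncomputable def jsDiv {n : ℕ} (p q : Fin n → ℝ) : ℝ :=
  (1 / 2) * ((∑ i, p i * Real.log (2 * p i / (p i + q i))) +
    ∑ i, q i * Real.log (2 * q i / (p i + q i)))

/-- J-divergence `J(P‖Q)`. -/
noncomputable def jDiv {n : ℕ} (p q : Fin n → ℝ) : ℝ :=
  ∑ i, (p i - q i) * Real.log (p i / q i)

/-- Arithmetic–geometric mean divergence `T(P‖Q)`. -/
noncomputable def agDiv {n : ℕ} (p q : Fin n → ℝ) : ℝ :=
  ∑ i, ((p i + q i) / 2) * Real.log ((p i + q i) / (2 * Real.sqrt (p i * q i)))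

/-- Symmetric chi-square divergence `Ψ(P‖Q)`. -/
noncomputable def psiDiv {n : ℕ} (p q : Fin n → ℝ) : ℝ :=
  ∑ i, (p i - q i) ^ 2 * (p i + q i) / (p i * q i)

/-- The d-divergence `d(P‖Q)`. -/
noncomputable def dDiv {n : ℕ} (p q : Fin n → ℝ) : ℝ :=
  1 - ∑ i, ((Real.sqrt (p i) + Real.sqrt (q i)) / 2) * Real.sqrt ((p i + q i) / 2)

/-- The perspective of a convex function on `(-1, 1)`, in the coordinates `s = a + b` and
`u = (a - b) / (a + b)`, is convex on the open positive quadrant. -/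
lemma ConvexOn.perspective_skew {ψ : ℝ → ℝ} (hψ : ConvexOn ℝ (Set.Ioo (-1) 1) ψ) :
    ConvexOn ℝ {x : ℝ × ℝ | 0 < x.1 ∧ 0 < x.2}
      (fun x => (x.1 + x.2) * ψ ((x.1 - x.2) / (x.1 + x.2))) := by
  have hmem : ∀ a b : ℝ, 0 < a → 0 < b → (a - b) / (a + b) ∈ Set.Ioo (-1 : ℝ) 1 := by
    intro a b ha hb
    constructor
    · rw [lt_div_iff₀ (by positivity)]; linarith
    · rw [div_lt_iff₀ (by positivity)]; linarith
  constructor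
  · exact (convex_halfSpace_gt (LinearMap.isLinear (LinearMap.fst ℝ ℝ ℝ)) 0).inter
      (convex_halfSpace_gt (LinearMap.isLinear (LinearMap.snd ℝ ℝ ℝ)) 0)
  · rintro ⟨x₁, x₂⟩ ⟨hx₁, hx₂⟩ ⟨y₁, y₂⟩ ⟨hy₁, hy₂⟩ a b ha hb hab
    simp only [Prod.smul_mk, Prod.mk_add_mk, smul_eq_mul] at *
    have hS : 0 < x₁ + x₂ := by positivity
    have hT : 0 < y₁ + y₂ := by positivity
    have hR : 0 < a * (x₁ + x₂) + b * (y₁ + y₂) := by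
      rcases ha.eq_or_lt with rfl | ha
      · have : b = 1 := by linarith
        subst this; linarith
      · positivity
    have hR' : a * x₁ + b * y₁ + (a * x₂ + b * y₂) = a * (x₁ + x₂) + b * (y₁ + y₂) := by ring
    have key := hψ.2 (hmem x₁ x₂ hx₁ hx₂) (hmem y₁ y₂ hy₁ hy₂)
      (show 0 ≤ a * (x₁ + x₂) / (a * (x₁ + x₂) + b * (y₁ + y₂)) by positivity)
      (show 0 ≤ b * (y₁ + y₂) / (a * (x₁ + x₂) + b * (y₁ + y₂)) by positivity)
      (by rw [← add_div, div_self hR.ne'])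
    simp only [smul_eq_mul] at key
    rw [hR']
    generalize a * (x₁ + x₂) + b * (y₁ + y₂) = R at *
    have harg : (a * x₁ + b * y₁ - (a * x₂ + b * y₂)) / R =
        a * (x₁ + x₂) / R * ((x₁ - x₂) / (x₁ + x₂)) +
          b * (y₁ + y₂) / R * ((y₁ - y₂) / (y₁ + y₂)) := by
      field_simp
      ring
    rw [harg]
    refine (mul_le_mul_of_nonneg_left key hR.le).trans_eq ?_
    field_simp

/-- The convex set of positive probability distributions. -/
lemma convex_probDist (n : ℕ) : Convex ℝ (ProbDist n) := by
  rintro p ⟨hp, hp'⟩ q ⟨hq, hq'⟩ a b ha hb hab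
  refine ⟨fun i => (convex_Ioi (0 : ℝ)) (hp i) (hq i) ha hb hab, ?_⟩
  simp [Finset.sum_add_distrib, ← Finset.mul_sum, hp', hq', hab]

/-- Sums of perspectives of a convex function are convex on pairs of distributions. -/
lemma convexOn_sum_perspective_skew (n : ℕ) {ψ : ℝ → ℝ} (hψ : ConvexOn ℝ (Set.Ioo (-1) 1) ψ) :
    ConvexOn ℝ (ProbDist n ×ˢ ProbDist n) (fun x : (Fin n → ℝ) × (Fin n → ℝ) =>
      ∑ i, (x.1 i + x.2 i) * ψ ((x.1 i - x.2 i) / (x.1 i + x.2 i))) := by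
  refine ⟨(convex_probDist n).prod (convex_probDist n), ?_⟩
  rintro ⟨p, q⟩ ⟨hp, hq⟩ ⟨p', q'⟩ ⟨hp', hq'⟩ a b ha hb hab
  simp only [smul_eq_mul, Finset.mul_sum, ← Finset.sum_add_distrib]
  refine Finset.sum_le_sum fun i _ => ?_
  have hx : (p i, q i) ∈ {x : ℝ × ℝ | 0 < x.1 ∧ 0 < x.2} := ⟨hp.1 i, hq.1 i⟩
  have hy : (p' i, q' i) ∈ {x : ℝ × ℝ | 0 < x.1 ∧ 0 < x.2} := ⟨hp'.1 i, hq'.1 i⟩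
  exact hψ.perspective_skew.2 hx hy ha hb hab

/-- An even convex function vanishing at `0` is nonnegative on `(-1, 1)`. -/
lemma ConvexOn.nonneg_of_even {ψ : ℝ → ℝ} (hψ : ConvexOn ℝ (Set.Ioo (-1) 1) ψ)
    (heven : ∀ u, ψ (-u) = ψ u) (h0 : ψ 0 = 0) {u : ℝ} (hu : u ∈ Set.Ioo (-1 : ℝ) 1) :
    0 ≤ ψ u := by
  have hu' : -u ∈ Set.Ioo (-1 : ℝ) 1 := ⟨by linarith [hu.2], by linarith [hu.1]⟩
  have h := hψ.2 hu hu' (one_half_pos (α := ℝ)).le one_half_pos.le (add_halves 1)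
  simp only [smul_eq_mul, heven] at h
  rw [show 1 / 2 * u + 1 / 2 * -u = 0 by ring, h0] at h
  linarith

lemma two_le_cube_add_cube {x y : ℝ} (hx : 0 ≤ x) (hy : 0 ≤ y) (h : x ^ 2 + y ^ 2 = 2) :
    2 ≤ x ^ 3 + y ^ 3 := by
  nlinarith [mul_nonneg (sq_nonneg (x - 1)) (by linarith : 0 ≤ 2 * x + 1),
    mul_nonneg (sq_nonneg (y - 1)) (by linarith : 0 ≤ 2 * y + 1)]

/-- The second derivative of `2 - √(1 + u) - √(1 - u)` is at least that of the generator of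
the Hellinger discrimination. -/
lemma one_div_two_mul_cube_le {u : ℝ} (hu : u ∈ Set.Ioo (-1 : ℝ) 1) :
    1 / (2 * √(1 - u ^ 2) ^ 3) ≤ 1 / (4 * √(1 + u) ^ 3) + 1 / (4 * √(1 - u) ^ 3) := by
  have h₁ : 0 < 1 + u := by linarith [hu.1]
  have h₂ : 0 < 1 - u := by linarith [hu.2]
  have hx := Real.sqrt_pos.2 h₁
  have hy := Real.sqrt_pos.2 h₂
  have hxy := two_le_cube_add_cube hx.le hy.le
    (by rw [Real.sq_sqrt h₁.le, Real.sq_sqrt h₂.le]; ring)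
  rw [show 1 - u ^ 2 = (1 + u) * (1 - u) by ring, Real.sqrt_mul h₁.le,
    div_add_div _ _ (by positivity) (by positivity), div_le_div_iff₀ (by positivity) (by positivity)]
  have : 0 < (√(1 + u) * √(1 - u)) ^ 3 := by positivity
  nlinarith

/-- If the second derivative of `k` is at most that of the generator of the Hellinger
discrimination, then subtracting `k` from the generator of `4 d` leaves a convex function. -/
lemma convexOn_two_sub_sqrt_sub {k k' k'' : ℝ → ℝ}
    (hk : ∀ u ∈ Set.Ioo (-1 : ℝ) 1, HasDerivAt k (k' u) u)
    (hk' : ∀ u ∈ Set.Ioo (-1 : ℝ) 1, HasDerivAt k' (k'' u) u)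
    (hle : ∀ u ∈ Set.Ioo (-1 : ℝ) 1, k'' u ≤ 1 / (2 * √(1 - u ^ 2) ^ 3)) :
    ConvexOn ℝ (Set.Ioo (-1) 1) (fun u => 2 - √(1 + u) - √(1 - u) - k u) := by
  have hd : ∀ u ∈ Set.Ioo (-1 : ℝ) 1,
      HasDerivAt (fun u => √(1 + u)) (1 / (2 * √(1 + u))) u ∧
      HasDerivAt (fun u => √(1 - u)) (-1 / (2 * √(1 - u))) u := fun u hu =>
    ⟨((hasDerivAt_id u).const_add 1).sqrt (by simp only [id]; linarith [hu.1]),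
      ((hasDerivAt_id u).const_sub 1).sqrt (by simp only [id]; linarith [hu.2])⟩
  have hψ : ∀ u ∈ Set.Ioo (-1 : ℝ) 1, HasDerivAt (fun u => 2 - √(1 + u) - √(1 - u) - k u)
      (-(1 / (2 * √(1 + u))) - -1 / (2 * √(1 - u)) - k' u) u := fun u hu =>
    (((hd u hu).1.const_sub 2).sub (hd u hu).2).sub (hk u hu)
  have hψ' : ∀ u ∈ Set.Ioo (-1 : ℝ) 1,
      HasDerivAt (fun u => -(1 / (2 * √(1 + u))) - -1 / (2 * √(1 - u)) - k' u)
      (1 / (4 * √(1 + u) ^ 3) + 1 / (4 * √(1 - u) ^ 3) - k'' u) u := by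
    intro u hu
    have hx : 0 < √(1 + u) := Real.sqrt_pos.2 (by linarith [hu.1])
    have hy : 0 < √(1 - u) := Real.sqrt_pos.2 (by linarith [hu.2])
    have h₁ := (hasDerivAt_const u (1 : ℝ)).div ((hd u hu).1.const_mul 2) (by positivity)
    have h₂ := (hasDerivAt_const u (-1 : ℝ)).div ((hd u hu).2.const_mul 2) (by positivity)
    refine ((h₁.neg.sub h₂).sub (hk' u hu)).congr_deriv ?_
    field_simp
    ring
  refine convexOn_of_hasDerivWithinAt2_nonneg (convex_Ioo _ _)
    (fun u hu => (hψ u hu).continuousAt.continuousWithinAt)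
    (fun u hu => (hψ u (interior_subset hu)).hasDerivWithinAt)
    (fun u hu => (hψ' u (interior_subset hu)).hasDerivWithinAt)
    (fun u hu => ?_)
  linarith [hle u (interior_subset hu), one_div_two_mul_cube_le (interior_subset hu)]

lemma convexOn_generator_triDelta :
    ConvexOn ℝ (Set.Ioo (-1) 1) (fun u : ℝ => 2 - √(1 + u) - √(1 - u) - u ^ 2 / 4) := by
  refine convexOn_two_sub_sqrt_sub (k' := fun u => u / 2) (k'' := fun _ => 1 / 2)
    (fun u _ => ?_) (fun u _ => (hasDerivAt_id u).div_const 2) (fun u hu => ?_)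
  · exact ((hasDerivAt_pow 2 u).div_const 4).congr_deriv (by norm_num; ring)
  · have hw : 0 < √(1 - u ^ 2) := Real.sqrt_pos.2 (by nlinarith [hu.1, hu.2])
    have hw' : √(1 - u ^ 2) ≤ 1 := Real.sqrt_le_one.2 (by nlinarith)
    have := pow_le_one₀ (n := 3) hw.le hw'
    exact one_div_le_one_div_of_le (by positivity) (by linarith)

lemma convexOn_generator_hellinger :
    ConvexOn ℝ (Set.Ioo (-1) 1)
      (fun u : ℝ => 2 - √(1 + u) - √(1 - u) - (1 - √(1 - u ^ 2)) / 2) := by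
  have hd : ∀ u ∈ Set.Ioo (-1 : ℝ) 1,
      HasDerivAt (fun u => √(1 - u ^ 2)) (-(u / √(1 - u ^ 2))) u := by
    intro u hu
    have h : 0 < 1 - u ^ 2 := by nlinarith [hu.1, hu.2]
    refine (((hasDerivAt_pow 2 u).const_sub 1).sqrt h.ne').congr_deriv ?_
    have := Real.sqrt_pos.2 h
    norm_num
    field_simp
  refine convexOn_two_sub_sqrt_sub (k' := fun u => u / √(1 - u ^ 2) / 2)
    (fun u hu => ?_) (fun u hu => ?_) (fun u _ => le_rfl)
  · exact (((hd u hu).const_sub 1).div_const 2).congr_deriv (by ring)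
  · have h : 0 < 1 - u ^ 2 := by nlinarith [hu.1, hu.2]
    have hw := Real.sqrt_pos.2 h
    have hs := Real.sq_sqrt h.le
    refine (((hasDerivAt_id u).div (hd u hu) hw.ne').div_const 2).congr_deriv ?_
    simp only [id]
    generalize √(1 - u ^ 2) = w at *
    field_simp
    linarith

lemma convexOn_generator_jsDiv :
    ConvexOn ℝ (Set.Ioo (-1) 1) (fun u : ℝ => 2 - √(1 + u) - √(1 - u) -
      ((1 + u) * log (1 + u) + (1 - u) * log (1 - u)) / 4) := by
  have hd₁ : ∀ u : ℝ, HasDerivAt (fun u : ℝ => 1 + u) 1 u := fun u =>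
    (hasDerivAt_id u).const_add 1
  have hd₂ : ∀ u : ℝ, HasDerivAt (fun u : ℝ => 1 - u) (-1) u := fun u =>
    (hasDerivAt_id u).const_sub 1
  refine convexOn_two_sub_sqrt_sub (k' := fun u => (log (1 + u) - log (1 - u)) / 4)
    (k'' := fun u => (1 / (1 + u) - -1 / (1 - u)) / 4)
    (fun u hu => ?_) (fun u hu => ?_) (fun u hu => ?_)
  all_goals
    have h₁ : 0 < 1 + u := by linarith [hu.1]
    have h₂ : 0 < 1 - u := by linarith [hu.2]
  · refine ((((hd₁ u).mul ((hd₁ u).log h₁.ne')).add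
      ((hd₂ u).mul ((hd₂ u).log h₂.ne'))).div_const 4).congr_deriv ?_
    field_simp
    ring
  · exact (((hd₁ u).log h₁.ne').sub ((hd₂ u).log h₂.ne')).div_const 4
  · have h : 0 < 1 - u ^ 2 := by nlinarith
    have hw := Real.sqrt_pos.2 h
    have hw' : √(1 - u ^ 2) ≤ 1 := Real.sqrt_le_one.2 (by nlinarith)
    have hs := Real.sq_sqrt h.le
    have heq : (1 / (1 + u) - -1 / (1 - u)) / 4 = 1 / (2 * √(1 - u ^ 2) ^ 2) := by
      rw [hs, show 1 - u ^ 2 = (1 + u) * (1 - u) by ring]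
      field_simp
      ring
    rw [heq]
    refine one_div_le_one_div_of_le (by positivity) ?_
    nlinarith [pow_pos hw 2]

/-- If `4 d - G` is the sum of perspectives of an even convex function vanishing at `0`, then it
is nonnegative and convex. -/
lemma nonneg_and_convexOn_four_dDiv_sub (n : ℕ) {G : (Fin n → ℝ) → (Fin n → ℝ) → ℝ} {k : ℝ → ℝ}
    (hconv : ConvexOn ℝ (Set.Ioo (-1) 1) (fun u => 2 - √(1 + u) - √(1 - u) - k u))
    (heven : ∀ u, k (-u) = k u) (h0 : k 0 = 0)
    (hG : ∀ p ∈ ProbDist n, ∀ q ∈ ProbDist n,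
      G p q = ∑ i, (p i + q i) * k ((p i - q i) / (p i + q i))) :
    (∀ p ∈ ProbDist n, ∀ q ∈ ProbDist n, 0 ≤ 4 * dDiv p q - G p q) ∧
      ConvexOn ℝ (ProbDist n ×ˢ ProbDist n)
        (fun x : (Fin n → ℝ) × (Fin n → ℝ) => 4 * dDiv x.1 x.2 - G x.1 x.2) := by
  have hsum : ∀ p ∈ ProbDist n, ∀ q ∈ ProbDist n, 4 * dDiv p q - G p q =
      ∑ i, (p i + q i) * (2 - √(1 + (p i - q i) / (p i + q i)) -
        √(1 - (p i - q i) / (p i + q i)) - k ((p i - q i) / (p i + q i))) := by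
    intro p hp q hq
    have hone : (4 : ℝ) = ∑ i, 2 * (p i + q i) := by
      rw [← Finset.mul_sum, Finset.sum_add_distrib, hp.2, hq.2]; norm_num
    rw [hG p hp q hq, dDiv, mul_sub, mul_one]
    nth_rewrite 1 [hone]
    rw [Finset.mul_sum, ← Finset.sum_sub_distrib, ← Finset.sum_sub_distrib]
    refine Finset.sum_congr rfl fun i _ => ?_
    have ha := hp.1 i
    have hb := hq.1 i
    generalize p i = a at *
    generalize q i = b at *
    generalize k ((a - b) / (a + b)) = c
    have hs : 0 < (a + b) / 2 := by positivity
    have hr := Real.sqrt_pos.2 hs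
    rw [show 1 + (a - b) / (a + b) = a / ((a + b) / 2) by field_simp; ring,
      show 1 - (a - b) / (a + b) = b / ((a + b) / 2) by field_simp; ring,
      Real.sqrt_div ha.le, Real.sqrt_div hb.le]
    have hr2 : a + b = 2 * √((a + b) / 2) ^ 2 := by rw [Real.sq_sqrt hs.le]; ring
    generalize √((a + b) / 2) = r at *
    rw [hr2]
    field_simp
    ring
  refine ⟨fun p hp q hq => ?_, (convexOn_sum_perspective_skew n hconv).congr
    fun x hx => (hsum x.1 hx.1 x.2 hx.2).symm⟩
  rw [hsum p hp q hq]
  refine Finset.sum_nonneg fun i _ => ?_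
  have ha := hp.1 i
  have hb := hq.1 i
  refine mul_nonneg (by positivity) (hconv.nonneg_of_even (fun u => ?_) ?_ ⟨?_, ?_⟩)
  · rw [heven, sub_neg_eq_add, ← sub_eq_add_neg]; ring
  · norm_num [h0]
  · rw [lt_div_iff₀ (by positivity)]; linarith
  · rw [div_lt_iff₀ (by positivity)]; linarith

lemma triDelta_eq_sum {n : ℕ} {p q : Fin n → ℝ} (hp : p ∈ ProbDist n) (hq : q ∈ ProbDist n) :
    1 / 4 * triDelta p q = ∑ i, (p i + q i) * (((p i - q i) / (p i + q i)) ^ 2 / 4) := by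
  rw [triDelta, Finset.mul_sum]
  refine Finset.sum_congr rfl fun i _ => ?_
  have := add_pos (hp.1 i) (hq.1 i)
  field_simp

lemma hellinger_eq_sum {n : ℕ} {p q : Fin n → ℝ} (hp : p ∈ ProbDist n) (hq : q ∈ ProbDist n) :
    hellinger p q =
      ∑ i, (p i + q i) * ((1 - √(1 - ((p i - q i) / (p i + q i)) ^ 2)) / 2) := by
  rw [hellinger, Finset.mul_sum]
  refine Finset.sum_congr rfl fun i _ => ?_
  have ha := hp.1 i
  have hb := hq.1 i
  have hs := add_pos ha hb
  rw [show 1 - ((p i - q i) / (p i + q i)) ^ 2 = 2 ^ 2 * (p i * q i) / (p i + q i) ^ 2 by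
      field_simp; ring,
    Real.sqrt_div (by positivity), Real.sqrt_mul (by positivity), Real.sqrt_sq hs.le,
    Real.sqrt_sq (by norm_num), Real.sqrt_mul ha.le, sub_sq, Real.sq_sqrt ha.le,
    Real.sq_sqrt hb.le]
  field_simp
  ring

lemma jsDiv_eq_sum {n : ℕ} {p q : Fin n → ℝ} (hp : p ∈ ProbDist n) (hq : q ∈ ProbDist n) :
    jsDiv p q = ∑ i, (p i + q i) *
      (((1 + (p i - q i) / (p i + q i)) * log (1 + (p i - q i) / (p i + q i)) +
        (1 - (p i - q i) / (p i + q i)) * log (1 - (p i - q i) / (p i + q i))) / 4) := by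
  rw [jsDiv, ← Finset.sum_add_distrib, Finset.mul_sum]
  refine Finset.sum_congr rfl fun i _ => ?_
  have hs := add_pos (hp.1 i) (hq.1 i)
  rw [show 1 + (p i - q i) / (p i + q i) = 2 * p i / (p i + q i) by field_simp; ring,
    show 1 - (p i - q i) / (p i + q i) = 2 * q i / (p i + q i) by field_simp; ring]
  field_simp
  ring

theorem d_differences_nonneg_and_convex (n : ℕ) (hn : 2 ≤ n) :
    (∀ p ∈ ProbDist n, ∀ q ∈ ProbDist n,
      0 ≤ 4 * dDiv p q - (1 / 4) * triDelta p q) ∧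
    (∀ p ∈ ProbDist n, ∀ q ∈ ProbDist n,
      0 ≤ 4 * dDiv p q - hellinger p q) ∧
    (∀ p ∈ ProbDist n, ∀ q ∈ ProbDist n,
      0 ≤ 4 * dDiv p q - jsDiv p q) ∧
    ConvexOn ℝ ((ProbDist n) ×ˢ (ProbDist n))
      (fun x : (Fin n → ℝ) × (Fin n → ℝ) =>
        4 * dDiv x.1 x.2 - (1 / 4) * triDelta x.1 x.2) ∧
    ConvexOn ℝ ((ProbDist n) ×ˢ (ProbDist n))
      (fun x : (Fin n → ℝ) × (Fin n → ℝ) =>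
        4 * dDiv x.1 x.2 - hellinger x.1 x.2) ∧
    ConvexOn ℝ ((ProbDist n) ×ˢ (ProbDist n))
      (fun x : (Fin n → ℝ) × (Fin n → ℝ) =>
        4 * dDiv x.1 x.2 - jsDiv x.1 x.2) := by
  obtain ⟨hΔ, hΔ'⟩ := nonneg_and_convexOn_four_dDiv_sub n
    (G := fun p q => 1 / 4 * triDelta p q) (k := fun u => u ^ 2 / 4)
    convexOn_generator_triDelta (fun u => by ring) (by norm_num)
    (fun _ hp _ hq => triDelta_eq_sum hp hq)
  obtain ⟨hh, hh'⟩ := nonneg_and_convexOn_four_dDiv_sub n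
    (G := hellinger) (k := fun u => (1 - √(1 - u ^ 2)) / 2)
    convexOn_generator_hellinger (fun u => by rw [neg_sq]) (by norm_num)
    (fun _ hp _ hq => hellinger_eq_sum hp hq)
  obtain ⟨hI, hI'⟩ := nonneg_and_convexOn_four_dDiv_sub n
    (G := jsDiv) (k := fun u => ((1 + u) * log (1 + u) + (1 - u) * log (1 - u)) / 4)
    convexOn_generator_jsDiv
    (fun u => by rw [sub_neg_eq_add, ← sub_eq_add_neg, add_comm]) (by norm_num)
    (fun _ hp _ hq => jsDiv_eq_sum hp hq)
  exact ⟨hΔ, hh, hI, hΔ', hh', hI'⟩
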